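/- Let V : ℝ² → ℝ be a harmonic polynomial of degree at least 3. Then the autonomous Hamiltonian system q̈(t) = -∇V(q(t)) is incomplete: there exists a maximal solution whose domain of definition is not all of ℝ. -/

import Mathlib

open Set

noncomputable section

/-- The Euclidean plane. -/
abbrev E2 := EuclideanSpace ℝ (Fin 2)

/-- A function `V : ℝ² → ℝ` is harmonic if its Laplacian vanishes identically. -/
def Harmonic2 (V : E2 → ℝ) : Prop :=
  ∀ p : E2, ∑ i : Fin 2,
    fderiv ℝ (fun q => fderiv ℝ V q (EuclideanSpace.single i 1)) p
      (EuclideanSpace.single i 1) = 0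

/-- `q` (with velocity `v`) solves the second-order ODE `q̈(t) = F (t, q(t))`
on the set `s`. -/
def SolOn (F : ℝ → E2 → E2) (q v : ℝ → E2) (s : Set ℝ) : Prop :=
  ∀ t ∈ s, HasDerivAt q (v t) t ∧ HasDerivAt v (F t (q t)) t

/-- `q` (with velocity `v`) is a maximal solution of `q̈(t) = F (t, q(t))` on
the open interval `s`. -/
def IsMaximalSolution (F : ℝ → E2 → E2) (q v : ℝ → E2) (s : Set ℝ) : Prop :=
  IsOpen s ∧ s.OrdConnected ∧ s.Nonempty ∧ SolOn F q v s ∧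
  ∀ (s' : Set ℝ) (q' v' : ℝ → E2), IsOpen s' → s'.OrdConnected → s ⊆ s' →
    SolOn F q' v' s' → (∀ t ∈ s, q' t = q t ∧ v' t = v t) → s' = s

open Topology in
/-- Every solution on a nonempty open interval extends to a maximal one. -/
theorem SolOn.exists_isMaximalSolution {F : ℝ → E2 → E2} {q₀ v₀ : ℝ → E2} {s₀ : Set ℝ}
    (hopen : IsOpen s₀) (hconn : s₀.OrdConnected) (hne : s₀.Nonempty)
    (hsol : SolOn F q₀ v₀ s₀) :
    ∃ (q v : ℝ → E2) (s : Set ℝ), IsMaximalSolution F q v s ∧ s₀ ⊆ s ∧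
      ∀ t ∈ s₀, q t = q₀ t ∧ v t = v₀ t := by
  classical
  let T := {x : Set ℝ × (ℝ → E2) × (ℝ → E2) // IsOpen x.1 ∧ x.1.OrdConnected ∧
    SolOn F x.2.1 x.2.2 x.1 ∧ s₀ ⊆ x.1 ∧ ∀ t ∈ s₀, x.2.1 t = q₀ t ∧ x.2.2 t = v₀ t}
  let r : T → T → Prop := fun x y => x.1.1 ⊆ y.1.1 ∧
    ∀ t ∈ x.1.1, y.1.2.1 t = x.1.2.1 t ∧ y.1.2.2 t = x.1.2.2 t
  have hrefl : ∀ x, r x x := fun x => ⟨subset_rfl, fun _ _ => ⟨rfl, rfl⟩⟩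
  obtain ⟨⟨⟨s, q, v⟩, h1, h2, h3, h4, h5⟩, hm⟩ := exists_maximal_of_chains_bounded (r := r) (by
    intro c hc
    rcases c.eq_empty_or_nonempty with rfl | ⟨x₀, hx₀⟩
    · exact ⟨⟨(s₀, q₀, v₀), hopen, hconn, hsol, subset_rfl, fun _ _ => ⟨rfl, rfl⟩⟩, by simp⟩
    let U : Set ℝ := ⋃ x ∈ c, x.1.1
    have hU : ∀ t, t ∈ U ↔ ∃ x ∈ c, t ∈ x.1.1 := by intro t; simp [U]
    let Q : ℝ → E2 := fun t => if h : ∃ x ∈ c, t ∈ x.1.1 then h.choose.1.2.1 t else 0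
    let W : ℝ → E2 := fun t => if h : ∃ x ∈ c, t ∈ x.1.1 then h.choose.1.2.2 t else 0
    have key : ∀ x ∈ c, ∀ t ∈ x.1.1, Q t = x.1.2.1 t ∧ W t = x.1.2.2 t := by
      intro x hx t ht
      have h : ∃ x ∈ c, t ∈ x.1.1 := ⟨x, hx, ht⟩
      have hQ : Q t = h.choose.1.2.1 t := by simp only [Q, dif_pos h]
      have hW : W t = h.choose.1.2.2 t := by simp only [W, dif_pos h]
      rw [hQ, hW]
      obtain ⟨ha, hb⟩ := h.choose_spec
      by_cases hxe : h.choose = x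
      · rw [hxe]; exact ⟨rfl, rfl⟩
      rcases hc ha hx hxe with hr | hr
      · obtain ⟨h1, h2⟩ := hr.2 t hb
        exact ⟨h1.symm, h2.symm⟩
      · exact hr.2 t ht
    have hUopen : IsOpen U := isOpen_biUnion fun x _ => x.2.1
    refine ⟨⟨(U, Q, W), hUopen, ?_, ?_, ?_, ?_⟩, ?_⟩
    · refine ⟨fun a ha b hb => ?_⟩
      obtain ⟨x, hx, hax⟩ := (hU a).1 ha
      obtain ⟨y, hy, hby⟩ := (hU b).1 hb
      rcases eq_or_ne x y with rfl | hxy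
      · exact (x.2.2.1.out hax hby).trans (subset_biUnion_of_mem (u := fun x : T => x.1.1) hx)
      rcases hc hx hy hxy with hr | hr
      · exact (y.2.2.1.out (hr.1 hax) hby).trans
          (subset_biUnion_of_mem (u := fun x : T => x.1.1) hy)
      · exact (x.2.2.1.out hax (hr.1 hby)).trans
          (subset_biUnion_of_mem (u := fun x : T => x.1.1) hx)
    · intro t ht
      obtain ⟨x, hx, htx⟩ := (hU t).1 ht
      have hnhds : x.1.1 ∈ 𝓝 t := x.2.1.mem_nhds htx
      obtain ⟨d1, d2⟩ := x.2.2.2.1 t htx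
      obtain ⟨e1, e2⟩ := key x hx t htx
      dsimp only
      rw [e2, e1]
      exact ⟨d1.congr_of_eventuallyEq
          (Filter.mem_of_superset hnhds fun u hu => (key x hx u hu).1),
        d2.congr_of_eventuallyEq
          (Filter.mem_of_superset hnhds fun u hu => (key x hx u hu).2)⟩
    · exact x₀.2.2.2.2.1.trans (subset_biUnion_of_mem (u := fun x : T => x.1.1) hx₀)
    · intro t ht
      obtain ⟨e1, e2⟩ := key x₀ hx₀ t (x₀.2.2.2.2.1 ht)
      obtain ⟨f1, f2⟩ := x₀.2.2.2.2.2 t ht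
      exact ⟨e1.trans f1, e2.trans f2⟩
    · intro x hx
      exact ⟨subset_biUnion_of_mem (u := fun x : T => x.1.1) hx, key x hx⟩)
    (fun {a b c} hab hbc => ⟨hab.1.trans hbc.1, fun t ht =>
      ⟨(hbc.2 t (hab.1 ht)).1.trans (hab.2 t ht).1, (hbc.2 t (hab.1 ht)).2.trans (hab.2 t ht).2⟩⟩)
  refine ⟨q, v, s, ⟨h1, h2, hne.mono h4, h3, ?_⟩, h4, h5⟩
  intro s' q' v' ho hc hs hsol' hag
  have := hm ⟨(s', q', v'), ho, hc, hsol', h4.trans hs, fun t ht =>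
    ⟨(hag t (h4 ht)).1.trans (h5 t ht).1, (hag t (h4 ht)).2.trans (h5 t ht).2⟩⟩ ⟨hs, hag⟩
  exact this.1.antisymm hs

/-- A `C¹` autonomous force field has a maximal solution through any initial state. -/
theorem exists_isMaximalSolution_of_contDiff {F : E2 → E2} (hF : ContDiff ℝ 1 F) (q₀ v₀ : E2) :
    ∃ (q v : ℝ → E2) (s : Set ℝ), IsMaximalSolution (fun _ p => F p) q v s ∧
      q 0 = q₀ ∧ v 0 = v₀ := by
  have hG : ContDiff ℝ 1 (fun p : E2 × E2 => (p.2, F p.1)) :=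
    contDiff_snd.prodMk (hF.comp contDiff_fst)
  obtain ⟨α, hα, ε, hε, hd⟩ :=
    (hG.contDiffAt (x := (q₀, v₀))).exists_forall_mem_closedBall_exists_eq_forall_mem_Ioo_hasDerivAt₀
      0
  have hmem : (0 : ℝ) ∈ Ioo (0 - ε) (0 + ε) := by constructor <;> linarith
  obtain ⟨q, v, s, hmax, -, hag⟩ := SolOn.exists_isMaximalSolution (F := fun _ p => F p)
    (q₀ := fun t => (α t).1) (v₀ := fun t => (α t).2) isOpen_Ioo ordConnected_Ioo ⟨0, hmem⟩
    (fun t ht => ⟨(hd t ht).fst, (hd t ht).snd⟩)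
  refine ⟨q, v, s, hmax, ?_, ?_⟩
  · rw [(hag 0 hmem).1, hα]
  · rw [(hag 0 hmem).2, hα]

/-- Virial-type blow-up criterion: no global `G`, `J` satisfy these differential inequalities. -/
theorem false_of_virial_inequalities {G J G' J' K : ℝ → ℝ} {α β : ℝ}
    (hα : 0 < α) (hαβ : 9 / 4 * β ≤ α)
    (hG : ∀ t, HasDerivAt G (G' t) t) (hJ : ∀ t, HasDerivAt J (J' t) t)
    (hJpos : ∀ t, 0 < J t) (hK : ∀ t, 0 ≤ K t) (hG' : ∀ t, α * K t ≤ G' t)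
    (hJ' : ∀ t, G t * J' t ≤ β * (2 * J t * K t)) (hGJK : ∀ t, G t ^ 2 ≤ 2 * J t * K t)
    (hG0 : 0 < G 0) : False := by
  have hGmono : Monotone G := monotone_of_hasDerivAt_nonneg hG
    fun t => (mul_nonneg hα.le (hK t)).trans (hG' t)
  have hGpos : ∀ t, 0 ≤ t → 0 < G t := fun t ht => hG0.trans_le (hGmono ht)
  have hM : MonotoneOn (fun t => G t ^ 8 / J t ^ 9) (Ici 0) := by
    have hd : ∀ t, HasDerivAt (fun t => G t ^ 8 / J t ^ 9)
        (G t ^ 7 / J t ^ 10 * (8 * G' t * J t - 9 * (G t * J' t))) t := by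
      intro t
      have hJt := (hJpos t).ne'
      refine (((hG t).pow 8).div ((hJ t).pow 9) (pow_ne_zero 9 hJt)).congr_deriv ?_
      simp only [Pi.pow_apply]
      field_simp
      push_cast
      ring
    refine monotoneOn_of_hasDerivWithinAt_nonneg (convex_Ici 0)
      (fun t _ => (hd t).continuousAt.continuousWithinAt)
      (fun t _ => (hd t).hasDerivWithinAt) fun t ht => ?_
    rw [interior_Ici, mem_Ioi] at ht
    have hJt := hJpos t
    refine mul_nonneg (div_nonneg (pow_nonneg (hGpos t ht.le).le 7) (pow_nonneg hJt.le 10)) ?_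
    have h1 := mul_le_mul_of_nonneg_right (hG' t) hJt.le
    have h2 := mul_le_mul_of_nonneg_right hαβ (mul_nonneg hJt.le (hK t))
    nlinarith [hJ' t]
  set c := G 0 ^ 8 / J 0 ^ 9 with hc
  have hcpos : 0 < c := div_pos (pow_pos hG0 8) (pow_pos (hJpos 0) 9)
  -- `J` is controlled by a power of `G`
  have hJG : ∀ t, 0 ≤ t → J t ≤ c ^ (-(1 / 9) : ℝ) * G t ^ (8 / 9 : ℝ) := by
    intro t ht
    have hGt := hGpos t ht
    have h1 : c ≤ G t ^ 8 / J t ^ 9 := hM self_mem_Ici (mem_Ici.2 ht) ht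
    rw [le_div_iff₀ (pow_pos (hJpos t) 9)] at h1
    have h2 : J t ^ 9 ≤ c⁻¹ * G t ^ 8 := by
      rw [inv_mul_eq_div, le_div_iff₀ hcpos]; linarith
    refine le_of_pow_le_pow_left₀ (n := 9) (by norm_num) (by positivity) ?_
    have e1 : (c ^ (-(1 / 9) : ℝ)) ^ 9 = c⁻¹ := by
      rw [← Real.rpow_mul_natCast hcpos.le]; norm_num [Real.rpow_neg_one]
    have e2 : (G t ^ (8 / 9 : ℝ)) ^ 9 = G t ^ 8 := by
      rw [← Real.rpow_mul_natCast hGt.le, ← Real.rpow_natCast]; norm_num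
    rw [mul_pow, e1, e2]
    exact h2
  set κ := α / (2 * c ^ (-(1 / 9) : ℝ)) / 9 with hκ
  have hκpos : 0 < κ := by positivity
  have hN : ∀ t, 0 ≤ t → G t ^ (-(1 / 9) : ℝ) ≤ G 0 ^ (-(1 / 9) : ℝ) - κ * t := by
    have hanti : AntitoneOn (fun t => G t ^ (-(1 / 9) : ℝ) + κ * t) (Ici 0) := by
      have hd : ∀ t, 0 ≤ t → HasDerivAt (fun t => G t ^ (-(1 / 9) : ℝ) + κ * t)
          (G' t * (-(1 / 9)) * G t ^ (-(1 / 9) - 1 : ℝ) + κ * 1) t := fun t ht =>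
        ((hG t).rpow_const (Or.inl (hGpos t ht).ne')).add ((hasDerivAt_id t).const_mul κ)
      refine antitoneOn_of_hasDerivWithinAt_nonpos (convex_Ici 0)
        (fun t ht => (hd t ht).continuousAt.continuousWithinAt)
        (fun t ht => (hd t (interior_subset ht)).hasDerivWithinAt) fun t ht => ?_
      rw [interior_Ici, mem_Ioi] at ht
      have hGt := hGpos t ht.le
      have hJt := hJpos t
      have h3 : α * G t ^ 2 ≤ G' t * (2 * J t) := by
        nlinarith [mul_le_mul_of_nonneg_right (hG' t) hJt.le,
          mul_le_mul_of_nonneg_left (hGJK t) hα.le]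
      have hG'0 : 0 ≤ G' t := (mul_nonneg hα.le (hK t)).trans (hG' t)
      have h4 : α * G t ^ 2 ≤ G' t * (2 * (c ^ (-(1 / 9) : ℝ) * G t ^ (8 / 9 : ℝ))) :=
        h3.trans (by gcongr; exact hJG t ht.le)
      have h5 : G t ^ 2 * G t ^ (-(1 / 9) - 1 : ℝ) = G t ^ (8 / 9 : ℝ) := by
        rw [← Real.rpow_natCast, ← Real.rpow_add hGt]; norm_num
      have hp : 0 < G t ^ (8 / 9 : ℝ) := by positivity
      have hcp : 0 < c ^ (-(1 / 9) : ℝ) := by positivity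
      have h6 : 9 * κ ≤ G' t * G t ^ (-(1 / 9) - 1 : ℝ) := by
        have h7 := mul_le_mul_of_nonneg_right h4
          (show 0 ≤ G t ^ (-(1 / 9) - 1 : ℝ) by positivity)
        rw [mul_assoc, h5] at h7
        rw [hκ, mul_div_cancel₀ _ (by norm_num : (9 : ℝ) ≠ 0), div_le_iff₀ (by positivity)]
        refine le_of_mul_le_mul_right (h7.trans_eq ?_) hp
        ring
      linarith
    intro t ht
    have := hanti self_mem_Ici (mem_Ici.2 ht) ht
    simp only [mul_zero, add_zero] at this
    linarith
  have ht0 : 0 ≤ G 0 ^ (-(1 / 9) : ℝ) / κ := by positivity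
  have h1 := hN _ ht0
  rw [mul_div_cancel₀ _ hκpos.ne', sub_self] at h1
  exact absurd h1 (not_le.2 (Real.rpow_pos_of_pos (hGpos _ ht0) _))

open Polynomial Asymptotics Bornology Topology in
/-- At infinity, `f` times its second derivative, divided by the square of its derivative, tends to
`(n - 1) / n`, where `n` is the degree of `f`. -/
theorem Polynomial.tendsto_mul_derivative_derivative_div_sq {f : ℂ[X]} (hf : 2 ≤ f.natDegree) :
    Filter.Tendsto (fun z => f.eval z * f.derivative.derivative.eval z / f.derivative.eval z ^ 2)
      (cobounded ℂ) (𝓝 (((f.natDegree : ℂ) - 1) / f.natDegree)) := by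
  obtain ⟨m, hm⟩ := Nat.exists_eq_add_of_le' hf
  have d1 : f.derivative.natDegree = m + 1 := by
    rw [natDegree_derivative, hm]; rfl
  have d2 : f.derivative.derivative.natDegree = m := by
    rw [natDegree_derivative, d1]; rfl
  have hlc : f.leadingCoeff ≠ 0 := by
    rw [Ne, leadingCoeff_eq_zero]; rintro rfl; simp at hm
  have l1 : f.derivative.leadingCoeff = f.leadingCoeff * (m + 2) := by
    rw [leadingCoeff, d1, coeff_derivative, leadingCoeff, hm]; push_cast; ring
  have l2 : f.derivative.derivative.leadingCoeff = f.leadingCoeff * (m + 2) * (m + 1) := by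
    rw [leadingCoeff, d2, coeff_derivative, ← l1, leadingCoeff, d1]
  have e := ((isEquivalent_cobounded_leading_monomial (P := f)).mul
    (isEquivalent_cobounded_leading_monomial (P := f.derivative.derivative))).div
    ((isEquivalent_cobounded_leading_monomial (P := f.derivative)).pow 2)
  rw [l1, l2, d1, d2, hm] at e
  refine e.symm.tendsto_nhds (tendsto_const_nhds.congr' ?_)
  have hev : ∀ᶠ z : ℂ in cobounded ℂ, z ≠ 0 := Bornology.eventually_ne_cobounded 0
  filter_upwards [hev] with z hz
  have h2 : (m : ℂ) + 2 ≠ 0 := by exact_mod_cast (by omega : m + 2 ≠ 0)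
  simp only [Pi.mul_apply, Pi.div_apply, Pi.pow_apply, hm]
  push_cast
  field_simp
  ring

open Polynomial Bornology ComplexConjugate in
/-- Some initial state admits no global motion with acceleration minus the conjugate of the
derivative of `f`, when `f` has degree at least `3`. -/
theorem exists_initial_state_not_global {f : ℂ[X]} (hf : 3 ≤ f.natDegree) :
    ∃ z₀ w₀ : ℂ, ∀ z w : ℝ → ℂ, (∀ t, HasDerivAt z (w t) t) →
      (∀ t, HasDerivAt w (-conj (f.derivative.eval (z t))) t) → z 0 = z₀ → w 0 = w₀ → False := by
  set n := f.natDegree with hn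
  set D : ℂ → ℂ := fun z =>
    1 - f.eval z * f.derivative.derivative.eval z / f.derivative.eval z ^ 2 with hD
  have hn3 : (3 : ℝ) ≤ n := by exact_mod_cast hf
  have hDlim : Filter.Tendsto D (cobounded ℂ) (nhds ((1 / n : ℝ) : ℂ)) := by
    have h := (tendsto_const_nhds (x := (1 : ℂ))).sub
      (tendsto_mul_derivative_derivative_div_sq (f := f) (by omega))
    convert h using 2
    have : (n : ℂ) ≠ 0 := by exact_mod_cast (by omega : n ≠ 0)
    push_cast
    rw [← hn]
    field_simp
    ring
  obtain ⟨R, hR⟩ : ∃ R, ∀ z : ℂ, R ≤ ‖z‖ →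
      f.derivative.eval z ≠ 0 ∧ ‖D z - ((1 / n : ℝ) : ℂ)‖ ≤ 1 / 100 := by
    have h1 := hDlim.eventually (Metric.closedBall_mem_nhds _ (by norm_num : (0 : ℝ) < 1 / 100))
    have h2 : ∀ᶠ z : ℂ in cobounded ℂ, f.derivative.eval z ≠ 0 := by
      have h3 := f.derivative.tendsto_norm_atTop (by
        rw [← natDegree_pos_iff_degree_pos, natDegree_derivative]; omega) (tendsto_norm_cobounded_atTop (E := ℂ))
      filter_upwards [h3.eventually_gt_atTop 0] with z hz
      exact norm_pos_iff.1 hz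
    have h4 := h2.and h1
    rw [← comap_norm_atTop, Filter.eventually_comap] at h4
    obtain ⟨R, hR⟩ := Filter.eventually_atTop.1 h4
    refine ⟨R, fun z hz => ?_⟩
    obtain ⟨a, b⟩ := hR _ hz z rfl
    exact ⟨a, by simpa [dist_eq_norm] using b⟩
  obtain ⟨M, hMpos, hM⟩ : ∃ M : ℝ, 0 < M ∧ ∀ z : ℂ, (f.eval z).re ≤ -M → R ≤ ‖z‖ := by
    obtain ⟨C, hC⟩ := (isCompact_closedBall (0 : ℂ) R).exists_bound_of_continuousOn
      f.continuous.continuousOn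
    refine ⟨|C| + 1, by positivity, fun z hz => ?_⟩
    by_contra! hlt
    have h1 := hC z (by simpa using hlt.le)
    have h2 := (Complex.abs_re_le_norm (f.eval z)).trans h1
    have h3 := neg_abs_le (f.eval z).re
    have h4 := le_abs_self C
    linarith
  obtain ⟨z₀, hz₀⟩ : ∃ z₀ : ℂ, f.eval z₀ = ((-(M + 1) : ℝ) : ℂ) := by
    obtain ⟨z₀, h⟩ := IsAlgClosed.exists_root (f - C ((-(M + 1) : ℝ) : ℂ)) (by
      have : 0 < (f - C ((-(M + 1) : ℝ) : ℂ)).degree := by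
        rw [← natDegree_pos_iff_degree_pos, natDegree_sub_C]; omega
      exact this.ne')
    exact ⟨z₀, by simpa [IsRoot, sub_eq_zero, eval_sub] using h⟩
  set X₀ := f.eval z₀ / f.derivative.eval z₀ with hX₀
  have hX₀ne : X₀ ≠ 0 := by
    refine div_ne_zero ?_ (hR z₀ (hM z₀ ?_)).1
    · rw [hz₀]; exact_mod_cast (by linarith : -(M + 1) ≠ 0)
    · rw [hz₀, Complex.ofReal_re]; linarith
  refine ⟨z₀, X₀ / ‖X₀‖, fun z w hz hw hz0 hw0 => ?_⟩
  have hfz : ∀ (g : ℂ[X]) (t : ℝ),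
      HasDerivAt (fun t => g.eval (z t)) (g.derivative.eval (z t) * w t) t :=
    fun g t => (g.hasDerivAt (z t)).comp t (hz t)
  -- conservation of energy
  have hE : ∀ t, ‖w t‖ ^ 2 / 2 + (f.eval (z t)).re = 1 / 2 - (M + 1) := by
    have hd : ∀ t, HasDerivAt (fun t => ‖w t‖ ^ 2 / 2 + inner ℝ (1 : ℂ) (f.eval (z t))) 0 t := by
      intro t
      refine (((hw t).norm_sq.div_const 2).add
        ((hasDerivAt_const t (1 : ℂ)).inner ℝ (hfz f t))).congr_deriv ?_
      simp [Complex.inner]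
    intro t
    have h := is_const_of_deriv_eq_zero (fun t => (hd t).differentiableAt)
      (fun t => (hd t).deriv) t 0
    have hnorm : ‖X₀ / (‖X₀‖ : ℂ)‖ = 1 := by
      rw [norm_div, Complex.norm_real, norm_norm, div_self (norm_ne_zero_iff.2 hX₀ne)]
    simp only [Complex.inner, map_one, mul_one] at h
    rw [h, hw0, hz0, hz₀, hnorm, Complex.ofReal_re]
    ring
  have hlow : ∀ t, (f.eval (z t)).re ≤ -M := by
    intro t
    have := hE t
    have := sq_nonneg ‖w t‖
    linarith
  have hf'ne : ∀ t, f.derivative.eval (z t) ≠ 0 := fun t => (hR _ (hM _ (hlow t))).1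
  set X : ℝ → ℂ := fun t => f.eval (z t) / f.derivative.eval (z t) with hX
  have hXd : ∀ t, HasDerivAt X (D (z t) * w t) t := by
    intro t
    have hne := hf'ne t
    refine ((hfz f t).div (hfz f.derivative t) hne).congr_deriv ?_
    simp only [hD]
    field_simp
  have hXne : ∀ t, X t ≠ 0 := by
    intro t
    refine div_ne_zero (fun h => ?_) (hf'ne t)
    have := hlow t
    rw [h, Complex.zero_re] at this
    linarith
  have hDbd : ∀ t, 1 / n - 1 / 100 ≤ (D (z t)).re ∧ ‖D (z t)‖ ≤ 1 / n + 1 / 100 := by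
    intro t
    have h1 := (hR _ (hM _ (hlow t))).2
    constructor
    · have h2 := (Complex.abs_re_le_norm _).trans h1
      rw [Complex.sub_re, Complex.ofReal_re, abs_le] at h2
      linarith [h2.1]
    · have h2 := norm_le_norm_add_norm_sub' (D (z t)) ((1 / n : ℝ) : ℂ)
      rw [Complex.norm_real, Real.norm_of_nonneg (by positivity)] at h2
      linarith
  have hinv : (1 : ℝ) / n ≤ 1 / 3 := one_div_le_one_div_of_le (by norm_num) hn3
  have hinv0 : (0 : ℝ) < 1 / n := by positivity
  refine false_of_virial_inequalities (G := fun t => inner ℝ (X t) (w t))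
    (J := fun t => ‖X t‖ ^ 2 / 2) (K := fun t => ‖w t‖ ^ 2) (α := 1 / 2 + 1 / n - 1 / 100)
    (β := 1 / n + 1 / 100) (by linarith) (by linarith)
    (fun t => (hXd t).inner ℝ (hw t)) (fun t => (hXd t).norm_sq.div_const 2)
    (fun t => div_pos (pow_pos (norm_pos_iff.2 (hXne t)) 2) two_pos) (fun t => sq_nonneg _)
    (fun t => ?_) (fun t => ?_) (fun t => ?_) ?_
  · have h1 : inner ℝ (X t) (-conj (f.derivative.eval (z t))) = -(f.eval (z t)).re := by
      have : f.eval (z t) = f.derivative.eval (z t) * X t := by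
        rw [hX]; field_simp [hf'ne t]
      rw [Complex.inner, this, neg_mul, ← map_mul, Complex.neg_re, Complex.conj_re]
    have h2 : inner ℝ (D (z t) * w t) (w t) = (D (z t)).re * ‖w t‖ ^ 2 := by
      rw [Complex.inner, map_mul, mul_left_comm, Complex.mul_conj', ← Complex.ofReal_pow,
        Complex.re_mul_ofReal, Complex.conj_re]
    rw [h1, h2]
    have h3 := mul_le_mul_of_nonneg_right (hDbd t).1 (sq_nonneg ‖w t‖)
    have := hE t
    linarith
  · have h1 := norm_inner_le_norm (𝕜 := ℝ) (X t) (w t)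
    have h2 := norm_inner_le_norm (𝕜 := ℝ) (X t) (D (z t) * w t)
    rw [norm_mul] at h2
    calc inner ℝ (X t) (w t) * (2 * inner ℝ (X t) (D (z t) * w t) / 2)
        ≤ ‖inner ℝ (X t) (w t)‖ * ‖inner ℝ (X t) (D (z t) * w t)‖ := by
          rw [mul_div_cancel_left₀ _ (two_ne_zero), ← norm_mul]; exact Real.le_norm_self _
      _ ≤ (‖X t‖ * ‖w t‖) * (‖X t‖ * ((1 / n + 1 / 100) * ‖w t‖)) := by
          refine mul_le_mul h1 (h2.trans ?_) (norm_nonneg _) (by positivity)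
          have := (hDbd t).2
          gcongr
      _ = _ := by ring
  · have h1 := abs_real_inner_le_norm (X t) (w t)
    calc inner ℝ (X t) (w t) ^ 2 = |inner ℝ (X t) (w t)| ^ 2 := (sq_abs _).symm
      _ ≤ (‖X t‖ * ‖w t‖) ^ 2 := by gcongr
      _ = _ := by ring
  · have h0 : X 0 = X₀ := by simp only [hX, hX₀, hz0]
    rw [h0, hw0, Complex.inner, div_mul_eq_mul_div, Complex.mul_conj', ← Complex.ofReal_pow,
      ← Complex.ofReal_div, Complex.ofReal_re]
    have := norm_pos_iff.2 hX₀ne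
    positivity

namespace MvPolynomial

theorem hasFDerivAt_eval_euclidean {ι : Type*} [Fintype ι] (P : MvPolynomial ι ℝ)
    (p : EuclideanSpace ℝ ι) :
    HasFDerivAt (fun r : EuclideanSpace ℝ ι => eval (fun i => r i) P)
      (∑ i, eval (fun j => p j) (pderiv i P) • (EuclideanSpace.proj i :
        EuclideanSpace ℝ ι →L[ℝ] ℝ)) p := by
  classical
  induction P using MvPolynomial.induction_on with
  | C a => simpa using hasFDerivAt_const a p
  | add P Q hP hQ =>
    simp only [map_add, add_smul, Finset.sum_add_distrib]
    exact hP.add hQ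
  | mul_X P n hP =>
    have hX : HasFDerivAt (fun r : EuclideanSpace ℝ ι => r n)
        (EuclideanSpace.proj n : EuclideanSpace ℝ ι →L[ℝ] ℝ) p :=
      (EuclideanSpace.proj n : EuclideanSpace ℝ ι →L[ℝ] ℝ).hasFDerivAt
    simp only [map_mul, eval_X]
    refine (hP.mul hX).congr_fderiv ?_
    simp only [pderiv_mul, map_add, map_mul, eval_X, pderiv_X, add_smul, Finset.sum_add_distrib,
      Finset.smul_sum, smul_smul]
    rw [add_comm]
    congr 1
    · refine Finset.sum_congr rfl fun i _ => ?_
      rw [mul_comm]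
    · rw [Finset.sum_eq_single n]
      · simp
      · intro i _ hi
        simp [hi.symm]
      · simp

theorem fderiv_eval_euclidean_single {ι : Type*} [Fintype ι] [DecidableEq ι]
    (P : MvPolynomial ι ℝ) (p : EuclideanSpace ℝ ι) (i : ι) :
    fderiv ℝ (fun r : EuclideanSpace ℝ ι => eval (fun i => r i) P) p
      (EuclideanSpace.single i 1) = eval (fun j => p j) (pderiv i P) := by
  rw [(hasFDerivAt_eval_euclidean P p).fderiv]
  simp

theorem gradient_eval_euclidean_apply {ι : Type*} [Fintype ι] (P : MvPolynomial ι ℝ)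
    (p : EuclideanSpace ℝ ι) (i : ι) :
    gradient (fun r : EuclideanSpace ℝ ι => eval (fun i => r i) P) p i =
      eval (fun j => p j) (pderiv i P) := by
  classical
  rw [← fderiv_eval_euclidean_single, ← toDual_gradient, InnerProductSpace.toDual_apply_apply,
    EuclideanSpace.inner_single_right]
  simp

theorem contDiff_gradient_eval_euclidean {ι : Type*} [Fintype ι] (P : MvPolynomial ι ℝ)
    {n : WithTop ℕ∞} :
    ContDiff ℝ n (gradient fun r : EuclideanSpace ℝ ι => eval (fun i => r i) P) := by
  rw [contDiff_euclidean]
  intro i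
  simp only [gradient_eval_euclidean_apply]
  generalize pderiv i P = Q
  induction Q using MvPolynomial.induction_on with
  | C a => simpa using contDiff_const
  | add P Q hP hQ => simpa only [map_add] using hP.add hQ
  | mul_X P n hP =>
    simp only [map_mul, eval_X]
    exact hP.mul (EuclideanSpace.proj n : EuclideanSpace ℝ ι →L[ℝ] ℝ).contDiff

theorem _root_.Harmonic2.laplacian_eq_zero {P : MvPolynomial (Fin 2) ℝ}
    (h : Harmonic2 (fun q : E2 => eval (fun i => q i) P)) :
    pderiv 0 (pderiv 0 P) + pderiv 1 (pderiv 1 P) = 0 := by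
  refine MvPolynomial.funext fun x => ?_
  have := h (WithLp.toLp 2 x)
  simp only [fderiv_eval_euclidean_single, Fin.sum_univ_two] at this
  simpa using this

theorem derivative_aeval {ι R A : Type*} [Fintype ι] [CommRing R] [CommRing A] [Algebra R A]
    (c : ι → Polynomial A) (P : MvPolynomial ι R) :
    Polynomial.derivative (aeval c P) =
      ∑ i, aeval c (pderiv i P) * Polynomial.derivative (c i) := by
  classical
  induction P using MvPolynomial.induction_on with
  | C a => simp [IsScalarTower.algebraMap_apply R A (Polynomial A)]
  | add P Q hP hQ => simp only [map_add, hP, hQ, add_mul, Finset.sum_add_distrib]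
  | mul_X P n hP =>
    simp only [map_mul, aeval_X, Polynomial.derivative_mul, hP, pderiv_mul, map_add, pderiv_X,
      add_mul, Finset.sum_add_distrib, Finset.sum_mul]
    refine congrArg₂ (· + ·) (Finset.sum_congr rfl fun i _ => mul_right_comm _ _ _) ?_
    rw [Finset.sum_eq_single n]
    · simp
    · intro i _ hi
      simp [hi.symm]
    · simp

theorem eval_aeval_polynomial {ι : Type*} (c : ι → Polynomial ℂ) (P : MvPolynomial ι ℝ) (s : ℂ) :
    (aeval c P).eval s = aeval (fun i => (c i).eval s) P := by
  have h := MvPolynomial.comp_aeval_apply (R := ℝ) c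
    ((Polynomial.aeval s : Polynomial ℂ →ₐ[ℂ] ℂ).restrictScalars ℝ) P
  simpa [Polynomial.coe_aeval_eq_eval] using h

open Complex in
/-- The complex derivative `∂₀ P - i ∂₁ P` of a harmonic polynomial is a polynomial in `x + i y`. -/
theorem exists_derivative_eval_eq {P : MvPolynomial (Fin 2) ℝ}
    (h : pderiv 0 (pderiv 0 P) + pderiv 1 (pderiv 1 P) = 0) :
    ∃ f : Polynomial ℂ, ∀ a b : ℂ, f.derivative.eval (a + I * b) =
      aeval ![a, b] (pderiv 0 P) - I * aeval ![a, b] (pderiv 1 P) := by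
  have hcomm : pderiv 0 (pderiv 1 P) = pderiv 1 (pderiv 0 P) := by
    ext m
    simp only [coeff_pderiv]
    rw [add_right_comm]
    simp
    ring
  have h11 : pderiv 1 (pderiv 1 P) = -pderiv 0 (pderiv 0 P) := (neg_eq_of_add_eq_zero_right h).symm
  refine ⟨Polynomial.C 2 * aeval ![Polynomial.C (1 / 2) * Polynomial.X,
    Polynomial.C (-I / 2) * Polynomial.X] P, fun a b => ?_⟩
  -- interpolate linearly between `(a, b)` and `(z / 2, -i z / 2)`, where `z = a + i b`
  set u : ℂ := (a + I * b) / 2 - a with hu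
  set v : ℂ := -I * (a + I * b) / 2 - b with hv
  have huv : u + I * v = 0 := by
    rw [hu, hv]; linear_combination (-(a + I * b) / 2) * I_sq
  have hvu : v - I * u = 0 := by linear_combination (-I) * huv + v * I_sq
  let c : Fin 2 → Polynomial ℂ := ![Polynomial.C a + Polynomial.C u * Polynomial.X,
    Polynomial.C b + Polynomial.C v * Polynomial.X]
  let Q : Polynomial ℂ := aeval c (pderiv 0 P) - Polynomial.C I * aeval c (pderiv 1 P)
  have hQ : Polynomial.derivative Q = 0 := by
    simp only [Q, Polynomial.derivative_sub, Polynomial.derivative_C_mul, derivative_aeval,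
      Fin.sum_univ_two, hcomm, h11, map_neg]
    simp only [c, Matrix.cons_val_zero, Matrix.cons_val_one, Polynomial.derivative_add,
      Polynomial.derivative_C, Polynomial.derivative_C_mul, Polynomial.derivative_X, zero_add,
      mul_one]
    have e1 : Polynomial.C u + Polynomial.C I * Polynomial.C v = 0 := by
      rw [← Polynomial.C_mul, ← Polynomial.C_add, huv, Polynomial.C_0]
    have e2 : Polynomial.C v - Polynomial.C I * Polynomial.C u = 0 := by
      rw [← Polynomial.C_mul, ← Polynomial.C_sub, hvu, Polynomial.C_0]
    linear_combination aeval c (pderiv 0 (pderiv 0 P)) * e1 +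
      aeval c (pderiv 1 (pderiv 0 P)) * e2
  have hconst : Q.eval 1 = Q.eval 0 := by
    obtain ⟨k, hk⟩ := Polynomial.natDegree_eq_zero.1 (Polynomial.derivative_eq_zero.1 hQ)
    simp [← hk]
  have c0 : (fun i => (c i).eval 0) = ![a, b] := by
    ext i; fin_cases i <;> simp [c]
  have c1 : (fun i => (c i).eval 1) = ![(a + I * b) / 2, -I * (a + I * b) / 2] := by
    ext i; fin_cases i <;> simp [c, hu, hv]
  have cz : (fun i => ((![Polynomial.C (1 / 2) * Polynomial.X,
      Polynomial.C (-I / 2) * Polynomial.X] : Fin 2 → Polynomial ℂ) i).eval (a + I * b)) =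
      ![(a + I * b) / 2, -I * (a + I * b) / 2] := by
    ext i
    fin_cases i
    · simp; ring
    · simp; ring
  simp only [Q, Polynomial.eval_sub, Polynomial.eval_mul, Polynomial.eval_C, eval_aeval_polynomial,
    c0, c1] at hconst
  rw [← hconst, Polynomial.derivative_C_mul, derivative_aeval, Fin.sum_univ_two]
  simp only [Polynomial.eval_mul, Polynomial.eval_add, Polynomial.eval_C, eval_aeval_polynomial, cz]
  simp
  ring

theorem totalDegree_le_two_of_pderiv {ι : Type*} {P : MvPolynomial ι ℝ}
    (h : ∀ i, (pderiv i P).totalDegree ≤ 1) : P.totalDegree ≤ 2 := by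
  classical
  refine Finset.sup_le fun m hm => ?_
  by_cases hm0 : m = 0
  · simp [hm0]
  obtain ⟨i, hi⟩ := Finsupp.ne_iff.1 hm0
  have hle : Finsupp.single i 1 ≤ m := by
    rw [Finsupp.single_le_iff]; exact Nat.one_le_iff_ne_zero.2 hi
  obtain ⟨k, rfl⟩ : ∃ k, m = k + Finsupp.single i 1 := ⟨_, (tsub_add_cancel_of_le hle).symm⟩
  have hk : k ∈ (pderiv i P).support := by
    rw [mem_support_iff, coeff_pderiv]
    exact mul_ne_zero (mem_support_iff.1 hm) (by positivity)
  have h1 := (le_totalDegree hk).trans (h i)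
  rw [Finsupp.sum_add_index' (by simp) (by simp)]
  simpa using h1

end MvPolynomial

open MvPolynomial Complex in
/-- The gradient of a harmonic polynomial, seen as a complex number, is the conjugate of the
derivative of a complex polynomial. -/
theorem MvPolynomial.exists_conj_derivative_eq {P : MvPolynomial (Fin 2) ℝ}
    (hdeg : 3 ≤ P.totalDegree)
    (hlap : pderiv 0 (pderiv 0 P) + pderiv 1 (pderiv 1 P) = 0) :
    ∃ f : Polynomial ℂ, 3 ≤ f.natDegree ∧ ∀ x : Fin 2 → ℝ,
      starRingEnd ℂ (f.derivative.eval (x 0 + I * x 1)) =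
        eval x (pderiv 0 P) + I * eval x (pderiv 1 P) := by
  obtain ⟨f, hf⟩ := exists_derivative_eval_eq hlap
  have hreal : ∀ x : Fin 2 → ℝ, f.derivative.eval (x 0 + I * x 1) =
      eval x (pderiv 0 P) - I * eval x (pderiv 1 P) := by
    intro x
    have hx : (![(x 0 : ℂ), (x 1 : ℂ)]) = algebraMap ℝ ℂ ∘ x := by
      ext i; fin_cases i <;> simp
    have hQ : ∀ Q : MvPolynomial (Fin 2) ℝ, aeval ![(x 0 : ℂ), (x 1 : ℂ)] Q = (eval x Q : ℂ) := by
      intro Q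
      rw [hx, aeval_algebraMap_apply]
      simp
    rw [hf, hQ, hQ]
  refine ⟨f, ?_, fun x => by rw [hreal]; simp⟩
  by_contra! hlt
  have hd : f.derivative.natDegree ≤ 1 := by
    rw [Polynomial.natDegree_derivative]; omega
  obtain ⟨c, d, hcd⟩ := Polynomial.exists_eq_X_add_C_of_natDegree_le_one hd
  simp only [hcd, Polynomial.eval_add, Polynomial.eval_mul, Polynomial.eval_C, Polynomial.eval_X]
    at hreal
  have haff : ∀ α β γ : ℝ, (C α + C β * X 0 + C γ * X 1 : MvPolynomial (Fin 2) ℝ).totalDegree ≤ 1 :=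
    fun α β γ => (totalDegree_add _ _).trans (max_le ((totalDegree_add _ _).trans (max_le (by simp)
      ((totalDegree_mul _ _).trans (by simp)))) ((totalDegree_mul _ _).trans (by simp)))
  have h0 : pderiv 0 P = C d.re + C c.re * X 0 + C (-c.im) * X 1 := by
    refine MvPolynomial.funext fun x => ?_
    have := congrArg Complex.re (hreal x)
    simp at this
    simp
    linarith
  have h1 : pderiv 1 P = C (-d.im) + C (-c.im) * X 0 + C (-c.re) * X 1 := by
    refine MvPolynomial.funext fun x => ?_
    have := congrArg Complex.im (hreal x)
    simp at this
    simp
    linarith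
  have := totalDegree_le_two_of_pderiv (P := P) (by
    intro i
    fin_cases i
    · simpa only [Fin.zero_eta, h0] using haff _ _ _
    · simpa only [Fin.mk_one, h1] using haff _ _ _)
  omega

/-- **Incompleteness for harmonic polynomial potentials of degree ≥ 3
(Flores–Sánchez).**  If `V : ℝ² → ℝ` is a harmonic polynomial of degree at
least `3`, then the system `q̈ = -∇V(q)` admits a maximal solution whose
domain is not all of `ℝ`. -/
theorem harmonic_poly_incomplete (P : MvPolynomial (Fin 2) ℝ)
    (hdeg : 3 ≤ P.totalDegree)
    (hharm : Harmonic2 (fun q : E2 => MvPolynomial.eval (fun i => q i) P)) :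
    ∃ (q v : ℝ → E2) (s : Set ℝ),
      IsMaximalSolution
        (fun _ p =>
          -gradient (fun r : E2 => MvPolynomial.eval (fun i => r i) P) p)
        q v s ∧ s ≠ univ := by
  obtain ⟨f, hf, hgrad⟩ := MvPolynomial.exists_conj_derivative_eq hdeg hharm.laplacian_eq_zero
  obtain ⟨z₀, w₀, hblow⟩ := exists_initial_state_not_global hf
  obtain ⟨q, v, s, hmax, hq0, hv0⟩ := exists_isMaximalSolution_of_contDiff
    (F := fun p => -gradient (fun r : E2 => MvPolynomial.eval (fun i => r i) P) p)
    (MvPolynomial.contDiff_gradient_eval_euclidean P).neg !₂[z₀.re, z₀.im] !₂[w₀.re, w₀.im]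
  refine ⟨q, v, s, hmax, ?_⟩
  rintro rfl
  have hsol := hmax.2.2.2.1
  have hcoord : ∀ {γ : ℝ → E2} {γ' : E2} {t : ℝ}, HasDerivAt γ γ' t →
      HasDerivAt (fun t => (γ t 0 : ℂ) + Complex.I * γ t 1) ((γ' 0 : ℂ) + Complex.I * γ' 1) t := by
    intro γ γ' t h
    have hi : ∀ i : Fin 2, HasDerivAt (fun t => γ t i) (γ' i) t := fun i =>
      (EuclideanSpace.proj i : E2 →L[ℝ] ℝ).hasFDerivAt.comp_hasDerivAt t h
    exact (hi 0).ofReal_comp.add ((hi 1).ofReal_comp.const_mul Complex.I)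
  refine hblow (fun t => q t 0 + Complex.I * q t 1) (fun t => v t 0 + Complex.I * v t 1)
    (fun t => hcoord (hsol t (mem_univ t)).1) (fun t => ?_) ?_ ?_
  · convert hcoord (hsol t (mem_univ t)).2 using 1
    rw [hgrad (fun i => q t i)]
    simp only [PiLp.neg_apply, MvPolynomial.gradient_eval_euclidean_apply]
    push_cast
    ring
  · simp [hq0, mul_comm Complex.I, Complex.re_add_im]
  · simp [hv0, mul_comm Complex.I, Complex.re_add_im]

end
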